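/- Let γ ⊂ ℙ² be an irreducible conic, let r ≥ 2, and let ℓ₁,…,ℓ_r, m₁,…,m_r be pairwise distinct lines all tangent to γ. Let X = 𝕊(ℓ₁,…,ℓ_r) and Y = 𝕊(m₁,…,m_r), and let Z = { m_i ∩ m_r : 1 ≤ i ≤ r−1 } be the r−1 collinear points of Y lying on m_r. Then every homogeneous form of degree r−1 in ℂ[x,y,z] vanishing at every point of X ∪ Z vanishes at every point of X ∪ Y; that is, (I_{X∪Z})_{r−1} = (I_{X∪Y})_{r−1}. -/

import Mathlib

open MvPolynomial

noncomputable section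

abbrev P2 : Type := Projectivization ℂ (Fin 3 → ℂ)

/-- A line in `ℙ²`: the zero locus of a nonzero linear form. -/
def IsLine (L : Set P2) : Prop :=
  ∃ a : Fin 3 → ℂ, a ≠ 0 ∧ L = {p : P2 | (∑ i, a i * p.rep i) = 0}

/-- An irreducible conic in `ℙ²`: the zero locus of an irreducible homogeneous quadratic form. -/
def IsIrredConic (γ : Set P2) : Prop :=
  ∃ q : MvPolynomial (Fin 3) ℂ, q.IsHomogeneous 2 ∧ Irreducible q ∧
    γ = {p : P2 | eval p.rep q = 0}

/-- `L` is tangent to `γ` : their intersection is a single point. -/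
def IsTangent (L γ : Set P2) : Prop := ∃ p : P2, L ∩ γ = {p}

/-- The star configuration defined by a family of lines: the set of points lying on at
least two of the lines. -/
def starConfig {r : ℕ} (L : Fin r → Set P2) : Set P2 :=
  {p : P2 | ∃ i j : Fin r, i ≠ j ∧ p ∈ L i ∧ p ∈ L j}

/-- A family of lines meets properly: they are distinct lines, no three concurrent. -/
def MeetsProperly {r : ℕ} (L : Fin r → Set P2) : Prop :=
  (∀ i, IsLine (L i)) ∧ Function.Injective L ∧
    ∀ (p : P2) (i j k : Fin r), p ∈ L i → p ∈ L j → p ∈ L k → i = j ∨ i = k ∨ j = k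

/-- `W` is a complete intersection of type `(a,b)`. -/
def IsCI (W : Set P2) (a b : ℕ) : Prop :=
  ∃ F G : MvPolynomial (Fin 3) ℂ, F ≠ 0 ∧ G ≠ 0 ∧
    F.IsHomogeneous a ∧ G.IsHomogeneous b ∧
    {p : P2 | eval p.rep F = 0 ∧ eval p.rep G = 0} = W ∧ W.ncard = a * b

/-- The `ℂ`-submodule of polynomials vanishing at every point of `W`. -/
def vanishingSubmodule (W : Set P2) : Submodule ℂ (MvPolynomial (Fin 3) ℂ) where
  carrier := {F : MvPolynomial (Fin 3) ℂ | ∀ p ∈ W, eval p.rep F = 0}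
  add_mem' := by
    intro a b ha hb p hp
    simp only [map_add, ha p hp, hb p hp, add_zero]
  zero_mem' := by
    intro p hp
    simp
  smul_mem' := by
    intro c F hF p hp
    simp only [smul_eval, hF p hp, mul_zero]

/-- The degree-`d` graded component of the vanishing ideal of `W`. -/
def idealComp (W : Set P2) (d : ℕ) : Submodule ℂ (MvPolynomial (Fin 3) ℂ) :=
  homogeneousSubmodule (Fin 3) ℂ d ⊓ vanishingSubmodule W

/-- The Hilbert function of `W ⊆ ℙ²`. -/
def HF (W : Set P2) (d : ℕ) : ℤ :=
  (Module.finrank ℂ ↥(homogeneousSubmodule (Fin 3) ℂ d) : ℤ) -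
    (Module.finrank ℂ ↥(idealComp W d) : ℤ)

/-- The h-vector of `W ⊆ ℙ²`. -/
def hvec (W : Set P2) : ℕ → ℤ
  | 0 => HF W 0
  | d + 1 => HF W (d + 1) - HF W d

/-- The (affine cone) ideal of a point of `ℙ²`; its powers cut out fat points. -/
def pointIdeal (p : P2) : Ideal (MvPolynomial (Fin 3) ℂ) := RingHom.ker (eval p.rep)

/-- The degree-`d` graded component of a homogeneous ideal `I`. -/
def idealCompI (I : Ideal (MvPolynomial (Fin 3) ℂ)) (d : ℕ) :
    Submodule ℂ (MvPolynomial (Fin 3) ℂ) :=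
  homogeneousSubmodule (Fin 3) ℂ d ⊓ Submodule.restrictScalars ℂ I

/-- The Hilbert function of `S/I`. -/
def HFI (I : Ideal (MvPolynomial (Fin 3) ℂ)) (d : ℕ) : ℤ :=
  (Module.finrank ℂ ↥(homogeneousSubmodule (Fin 3) ℂ d) : ℤ) -
    (Module.finrank ℂ ↥(idealCompI I d) : ℤ)

/-- The h-vector of `S/I`. -/
def hvecI (I : Ideal (MvPolynomial (Fin 3) ℂ)) : ℕ → ℤ
  | 0 => HFI I 0
  | d + 1 => HFI I (d + 1) - HFI I d

/-- The Hadamard-product relation: `R = P ⋆ Q`. -/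
def hadRel (P Q R : P2) : Prop :=
  ∃ (u v : Fin 3 → ℂ) (hu : u ≠ 0) (hv : v ≠ 0) (huv : (fun i => u i * v i) ≠ 0),
    Projectivization.mk ℂ u hu = P ∧ Projectivization.mk ℂ v hv = Q ∧
      Projectivization.mk ℂ (fun i => u i * v i) huv = R

/-- `Δ₀`: points of `ℙ²` with at most one nonzero coordinate. -/
def Δ₀ : Set P2 := {p : P2 | ∃ i : Fin 3, ∀ j : Fin 3, j ≠ i → p.rep j = 0}


/-- The homogeneous linear polynomial attached to a linear functional. -/
def linearFormPoly (f : (Fin 3 → ℂ) →ₗ[ℂ] ℂ) : MvPolynomial (Fin 3) ℂ :=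
  ∑ i, C (f (Pi.single i 1)) * X i

lemma eval_linearFormPoly (f : (Fin 3 → ℂ) →ₗ[ℂ] ℂ) (v : Fin 3 → ℂ) :
    eval v (linearFormPoly f) = f v := by
  simp_rw [linearFormPoly, map_sum, map_mul, eval_C, eval_X, mul_comm _ (v _)]
  conv_rhs => rw [← Finset.univ_sum_single v, map_sum]
  refine Finset.sum_congr rfl fun i _ => ?_
  rw [← smul_eq_mul, ← map_smul, ← Pi.single_smul, smul_eq_mul, mul_one]

lemma not_irreducible_of_eval_eq_mul {q : MvPolynomial (Fin 3) ℂ}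
    (f g : (Fin 3 → ℂ) →ₗ[ℂ] ℂ) (h : ∀ v, eval v q = f v * g v) : ¬ Irreducible q := by
  intro hq
  have hq' : q = linearFormPoly f * linearFormPoly g :=
    MvPolynomial.funext fun v => by rw [map_mul, eval_linearFormPoly, eval_linearFormPoly, h]
  have hunit : ∀ f, ¬ IsUnit (linearFormPoly f) := fun f hf => by
    have := hf.map (eval (0 : Fin 3 → ℂ))
    rw [eval_linearFormPoly, map_zero] at this
    exact not_isUnit_zero this
  rcases hq.isUnit_or_isUnit hq' with hf | hf <;> exact hunit _ hf

lemma not_irreducible_of_eval_eq_add_sq {q : MvPolynomial (Fin 3) ℂ}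
    (f g : (Fin 3 → ℂ) →ₗ[ℂ] ℂ) (c d : ℂ)
    (h : ∀ v, eval v q = c * (f v * f v) + d * (g v * g v)) : ¬ Irreducible q := by
  obtain ⟨a, rfl⟩ := IsAlgClosed.exists_eq_mul_self c
  obtain ⟨b, rfl⟩ := IsAlgClosed.exists_eq_mul_self d
  refine not_irreducible_of_eval_eq_mul (a • f + (Complex.I * b) • g)
    (a • f - (Complex.I * b) • g) fun v => ?_
  simp only [h, LinearMap.add_apply, LinearMap.sub_apply, LinearMap.smul_apply, smul_eq_mul]
  linear_combination b * b * (g v * g v) * Complex.I_sq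

lemma exists_quadraticForm_eq_monomial (d : Fin 3 →₀ ℕ) (hd : d.degree = 2) (c : ℂ) :
    ∃ Q : QuadraticForm ℂ (Fin 3 → ℂ), ∀ v, Q v = eval v (monomial d c) := by
  have hsum : d 0 + d 1 + d 2 = 2 := by
    rw [← Fin.sum_univ_three (fun i => d i), ← Finsupp.degree_eq_sum, hd]
  have key : ∃ i j : Fin 3, ∀ v : Fin 3 → ℂ, v 0 ^ d 0 * v 1 ^ d 1 * v 2 ^ d 2 = v i * v j := by
    have h : d 0 = 2 ∧ d 1 = 0 ∧ d 2 = 0 ∨ d 0 = 0 ∧ d 1 = 2 ∧ d 2 = 0 ∨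
        d 0 = 0 ∧ d 1 = 0 ∧ d 2 = 2 ∨ d 0 = 1 ∧ d 1 = 1 ∧ d 2 = 0 ∨
        d 0 = 1 ∧ d 1 = 0 ∧ d 2 = 1 ∨ d 0 = 0 ∧ d 1 = 1 ∧ d 2 = 1 := by omega
    rcases h with ⟨h0, h1, h2⟩ | ⟨h0, h1, h2⟩ | ⟨h0, h1, h2⟩ | ⟨h0, h1, h2⟩ | ⟨h0, h1, h2⟩ |
      ⟨h0, h1, h2⟩ <;> simp only [h0, h1, h2]
    exacts [⟨0, 0, fun v => by ring⟩, ⟨1, 1, fun v => by ring⟩, ⟨2, 2, fun v => by ring⟩,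
      ⟨0, 1, fun v => by ring⟩, ⟨0, 2, fun v => by ring⟩, ⟨1, 2, fun v => by ring⟩]
  obtain ⟨i, j, hij⟩ := key
  refine ⟨c • QuadraticMap.linMulLin (LinearMap.proj i) (LinearMap.proj j), fun v => ?_⟩
  rw [eval_monomial, Finsupp.prod_fintype _ _ (by simp), Fin.prod_univ_three, hij]
  simp

lemma exists_quadraticForm_eq_eval {q : MvPolynomial (Fin 3) ℂ} (hq : q.IsHomogeneous 2) :
    ∃ Q : QuadraticForm ℂ (Fin 3 → ℂ), ∀ v, Q v = eval v q := by
  have h : ∀ d ∈ q.support, ∃ Q : QuadraticForm ℂ (Fin 3 → ℂ),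
      ∀ v, Q v = eval v (monomial d (q.coeff d)) := fun d hd =>
    exists_quadraticForm_eq_monomial d
      (by rw [Finsupp.degree_eq_weight_one]; exact hq (mem_support_iff.1 hd)) _
  choose! Q hQ using h
  refine ⟨∑ d ∈ q.support, Q d, fun v => ?_⟩
  conv_rhs => rw [q.as_sum, map_sum]
  rw [sum_apply]
  exact Finset.sum_congr rfl fun d hd => hQ d hd v

lemma exists_diagonalization {q : MvPolynomial (Fin 3) ℂ} (hq : q.IsHomogeneous 2) :
    ∃ (w : Fin 3 → ℂ) (e : (Fin 3 → ℂ) ≃ₗ[ℂ] (Fin 3 → ℂ)),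
      ∀ v, eval v q = ∑ i, w i * (e v i * e v i) := by
  obtain ⟨Q, hQ⟩ := exists_quadraticForm_eq_eval hq
  have h := Q.equivalent_weightedSumSquares
  rw [Module.finrank_fin_fun] at h
  obtain ⟨w, ⟨e⟩⟩ := h
  refine ⟨w, e.toLinearEquiv, fun v => ?_⟩
  rw [← hQ, ← e.map_app v, QuadraticMap.weightedSumSquares_apply]
  rfl

/-- Every irreducible conic over `ℂ` is `X Z = Y²` in suitable linear coordinates. -/
lemma exists_conic_normal_form {q : MvPolynomial (Fin 3) ℂ} (hq : q.IsHomogeneous 2)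
    (hirr : Irreducible q) : ∃ e : (Fin 3 → ℂ) ≃ₗ[ℂ] (Fin 3 → ℂ),
      ∀ v, eval v q = e v 0 * e v 2 - e v 1 ^ 2 := by
  obtain ⟨w, e, he⟩ := exists_diagonalization hq
  simp only [Fin.sum_univ_three] at he
  let E : Fin 3 → (Fin 3 → ℂ) →ₗ[ℂ] ℂ := fun i => LinearMap.proj i ∘ₗ e.toLinearMap
  have h0 : w 0 ≠ 0 := fun h => not_irreducible_of_eval_eq_add_sq (E 1) (E 2) (w 1) (w 2)
    (fun v => by simp [he, h, E]) hirr
  have h1 : w 1 ≠ 0 := fun h => not_irreducible_of_eval_eq_add_sq (E 0) (E 2) (w 0) (w 2)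
    (fun v => by simp [he, h, E]) hirr
  have h2 : w 2 ≠ 0 := fun h => not_irreducible_of_eval_eq_add_sq (E 0) (E 1) (w 0) (w 1)
    (fun v => by simp [he, h, E]) hirr
  obtain ⟨a, ha⟩ := IsAlgClosed.exists_eq_mul_self (w 0)
  obtain ⟨b, hb⟩ := IsAlgClosed.exists_eq_mul_self (w 1)
  obtain ⟨c, hc⟩ := IsAlgClosed.exists_eq_mul_self (w 2)
  have ha0 : a ≠ 0 := by rintro rfl; simp_all
  have hb0 : b ≠ 0 := by rintro rfl; simp_all
  have hc0 : c ≠ 0 := by rintro rfl; simp_all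
  let T : (Fin 3 → ℂ) →ₗ[ℂ] (Fin 3 → ℂ) :=
    LinearMap.pi ![a • E 0 + (Complex.I * b) • E 1, (Complex.I * c) • E 2,
      a • E 0 - (Complex.I * b) • E 1]
  have hT : ∀ v, T v 0 = a * e v 0 + Complex.I * b * e v 1 ∧ T v 1 = Complex.I * c * e v 2 ∧
      T v 2 = a * e v 0 - Complex.I * b * e v 1 := fun v => by simp [T, E]
  have hinj : Function.Injective T := by
    rw [injective_iff_map_eq_zero]
    intro v hv
    obtain ⟨t0, t1, t2⟩ := hT v
    simp only [hv, Pi.zero_apply] at t0 t1 t2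
    have e0 : e v 0 = 0 := by
      have : 2 * a * e v 0 = 0 := by linear_combination - t0 - t2
      simpa [ha0] using this
    have e1 : e v 1 = 0 := by
      have : 2 * Complex.I * b * e v 1 = 0 := by linear_combination - t0 + t2
      simpa [hb0] using this
    have e2 : e v 2 = 0 := by simpa [hc0] using t1.symm
    apply e.injective
    ext i
    fin_cases i <;> simp [e0, e1, e2]
  refine ⟨LinearEquiv.ofInjectiveEndo T hinj, fun v => ?_⟩
  obtain ⟨t0, t1, t2⟩ := hT v
  simp only [LinearEquiv.coe_ofInjectiveEndo, t0, t1, t2, he, ha, hb, hc]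
  linear_combination (c * c * e v 2 * e v 2 + b * b * e v 1 * e v 1) * Complex.I_sq

lemma exists_line_coefficients (e : (Fin 3 → ℂ) ≃ₗ[ℂ] (Fin 3 → ℂ)) {a : Fin 3 → ℂ}
    (ha : a ≠ 0) : ∃ A : Fin 3 → ℂ, A ≠ 0 ∧
      ∀ v, ∑ i, a i * v i = A 0 * e v 0 + A 1 * e v 1 + A 2 * e v 2 := by
  have h : ∀ v, ∑ i, a i * v i = ∑ j, (∑ i, a i * e.symm (Pi.single j 1) i) * e v j := by
    intro v
    let f : (Fin 3 → ℂ) →ₗ[ℂ] ℂ := ∑ i, a i • LinearMap.proj i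
    have hf : ∀ v, f v = ∑ i, a i * v i := fun v => by simp [f]
    have := eval_linearFormPoly (f ∘ₗ e.symm.toLinearMap) (e v)
    simpa [hf, linearFormPoly] using this.symm
  refine ⟨fun j => ∑ i, a i * e.symm (Pi.single j 1) i, fun hA => ha ?_, fun v => ?_⟩
  · ext i
    have := h (Pi.single i 1)
    simpa [Pi.single_apply, fun j => congrFun hA j] using this
  · rw [h, Fin.sum_univ_three]

/-- Every nonzero vector `u` is the coordinate vector, in the system `e`, of a point of `ℙ²`. -/
lemma exists_point_rep (e : (Fin 3 → ℂ) ≃ₗ[ℂ] (Fin 3 → ℂ)) {u : Fin 3 → ℂ} (hu : u ≠ 0) :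
    ∃ p : P2, ∃ c : ℂ, c ≠ 0 ∧ p.rep = c • e.symm u ∧ e p.rep = c • u := by
  have hu' : e.symm u ≠ 0 := by simpa using hu
  obtain ⟨c, hc⟩ := Projectivization.exists_smul_eq_mk_rep ℂ (e.symm u) hu'
  exact ⟨Projectivization.mk ℂ (e.symm u) hu', c, c.ne_zero, hc.symm, by
    rw [← hc, Units.smul_def, map_smul, e.apply_symm_apply]⟩

/-- A line `A₀ X + A₁ Y + A₂ Z = 0` tangent to the conic `X Z = Y²` has vanishing discriminant. -/
lemma discriminant_eq_zero_of_isTangent {γ L : Set P2} (e : (Fin 3 → ℂ) ≃ₗ[ℂ] (Fin 3 → ℂ))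
    (hγ : ∀ p, p ∈ γ ↔ e p.rep 0 * e p.rep 2 - e p.rep 1 ^ 2 = 0) {A : Fin 3 → ℂ}
    (hL : ∀ p, p ∈ L ↔ A 0 * e p.rep 0 + A 1 * e p.rep 1 + A 2 * e p.rep 2 = 0)
    (ht : IsTangent L γ) : A 1 ^ 2 = 4 * A 0 * A 2 := by
  obtain ⟨p₀, hp₀⟩ := ht
  have key : ∀ s t s' t' : ℂ, A 0 * s ^ 2 + A 1 * (s * t) + A 2 * t ^ 2 = 0 →
      A 0 * s' ^ 2 + A 1 * (s' * t') + A 2 * t' ^ 2 = 0 → s * t' = t * s' ∨ (s = 0 ∧ t = 0) ∨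
        (s' = 0 ∧ t' = 0) := by
    intro s t s' t' h h'
    by_cases hst : s = 0 ∧ t = 0
    · exact Or.inr (Or.inl hst)
    by_cases hst' : s' = 0 ∧ t' = 0
    · exact Or.inr (Or.inr hst')
    left
    have point : ∀ s t : ℂ, A 0 * s ^ 2 + A 1 * (s * t) + A 2 * t ^ 2 = 0 → ¬ (s = 0 ∧ t = 0) →
        ∃ c : ℂ, c ≠ 0 ∧ e p₀.rep = c • ![s ^ 2, s * t, t ^ 2] := by
      intro s t h hst
      have hu : ![s ^ 2, s * t, t ^ 2] ≠ 0 := fun h0 => hst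
        ⟨by simpa using congrFun h0 0, by simpa using congrFun h0 2⟩
      obtain ⟨p, c, hc, -, hp⟩ := exists_point_rep e hu
      have hmem : p ∈ L ∩ γ := by
        refine ⟨(hL p).2 ?_, (hγ p).2 ?_⟩ <;> simp [hp]
        · linear_combination c * h
        · ring
      rw [hp₀, Set.mem_singleton_iff] at hmem
      exact ⟨c, hc, hmem ▸ hp⟩
    obtain ⟨c, hc, h1⟩ := point s t h hst
    obtain ⟨c', hc', h2⟩ := point s' t' h' hst'
    have h3 := h1.symm.trans h2
    have e0 : c * s ^ 2 = c' * s' ^ 2 := by simpa using congrFun h3 0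
    have e1 : c * (s * t) = c' * (s' * t') := by simpa using congrFun h3 1
    have e2 : c * t ^ 2 = c' * t' ^ 2 := by simpa using congrFun h3 2
    have hsq : c * (s * t' - t * s') ^ 2 = 0 := by
      linear_combination t' ^ 2 * e0 - 2 * s' * t' * e1 + s' ^ 2 * e2
    have := pow_eq_zero_iff (two_ne_zero) |>.1 ((mul_eq_zero.1 hsq).resolve_left hc)
    exact sub_eq_zero.1 this
  obtain ⟨δ, hδ⟩ := IsAlgClosed.exists_eq_mul_self (A 1 ^ 2 - 4 * A 0 * A 2)
  by_cases h0 : A 0 = 0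
  · rcases key 1 0 (-A 2) (A 1) (by simp [h0]) (by rw [h0]; ring) with h | h | h
    · simp_all
    · simp_all
    · simp [h.2, h0]
  · rcases key (-A 1 + δ) (2 * A 0) (-A 1 - δ) (2 * A 0)
      (by linear_combination -A 0 * hδ) (by linear_combination -A 0 * hδ) with h | h | h
    · have : 4 * A 0 * δ = 0 := by linear_combination h
      have hd : δ = 0 := by simpa [h0] using this
      rw [hd] at hδ
      linear_combination hδ
    · simp [h0] at h
    · simp [h0] at h

lemma exists_dual_conic_parameter {A : Fin 3 → ℂ} (hA : A ≠ 0) (hd : A 1 ^ 2 = 4 * A 0 * A 2) :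
    ∃ s t : ℂ, (s ≠ 0 ∨ t ≠ 0) ∧ A 0 = t ^ 2 ∧ A 1 = -2 * s * t ∧ A 2 = s ^ 2 := by
  obtain ⟨t, ht⟩ := IsAlgClosed.exists_eq_mul_self (A 0)
  by_cases h0 : t = 0
  · obtain ⟨s, hs⟩ := IsAlgClosed.exists_eq_mul_self (A 2)
    have hA0 : A 0 = 0 := by simp [ht, h0]
    have hA1 : A 1 = 0 := by simpa [hA0] using hd
    refine ⟨s, t, Or.inl ?_, by rw [ht]; ring, by rw [hA1, h0]; ring, by rw [hs]; ring⟩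
    rintro rfl
    apply hA
    ext i
    fin_cases i <;> simp [hA0, hA1, hs]
  · refine ⟨-A 1 / (2 * t), t, Or.inr h0, by rw [ht]; ring, by field_simp, ?_⟩
    field_simp
    rw [ht] at hd
    have : t * t ≠ 0 := mul_ne_zero h0 h0
    linear_combination -hd

lemma exists_forall_ne_mul {ι : Type*} [Finite ι] (s t : ι → ℂ) (h : ∀ i, s i ≠ 0 ∨ t i ≠ 0) :
    ∃ x : ℂ, ∀ i, t i - x * s i ≠ 0 := by
  obtain ⟨x, hx⟩ := (Set.finite_range fun i => t i / s i).exists_notMem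
  refine ⟨x, fun i hi => hx ⟨i, ?_⟩⟩
  have hs : s i ≠ 0 := by
    intro hs
    have ht : t i = 0 := by simpa [hs] using hi
    simpa [hs, ht] using h i
  simp only
  rw [div_eq_iff hs]
  linear_combination hi

/-- In suitable linear coordinates, finitely many tangents to an irreducible conic have
equations `X - 2 s Y + s² Z = 0`. -/
lemma exists_tangent_coordinates {γ : Set P2} (hγ : IsIrredConic γ) {ι : Type*} [Finite ι]
    (L : ι → Set P2) (hline : ∀ i, IsLine (L i)) (htan : ∀ i, IsTangent (L i) γ) :
    ∃ (e : (Fin 3 → ℂ) ≃ₗ[ℂ] (Fin 3 → ℂ)) (s : ι → ℂ), ∀ i p,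
      p ∈ L i ↔ e p.rep 0 - 2 * s i * e p.rep 1 + s i ^ 2 * e p.rep 2 = 0 := by
  obtain ⟨q, hq, hirr, rfl⟩ := hγ
  obtain ⟨e, he⟩ := exists_conic_normal_form hq hirr
  have h : ∀ i, ∃ s t : ℂ, (s ≠ 0 ∨ t ≠ 0) ∧ ∀ p, p ∈ L i ↔
      t ^ 2 * e p.rep 0 - 2 * s * t * e p.rep 1 + s ^ 2 * e p.rep 2 = 0 := by
    intro i
    obtain ⟨a, ha, hL⟩ := hline i
    obtain ⟨A, hA, hAe⟩ := exists_line_coefficients e ha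
    have hL' : ∀ p, p ∈ L i ↔ A 0 * e p.rep 0 + A 1 * e p.rep 1 + A 2 * e p.rep 2 = 0 :=
      fun p => by rw [hL, Set.mem_ofPred_eq, hAe]
    obtain ⟨s, t, hst, h0, h1, h2⟩ := exists_dual_conic_parameter hA
      (discriminant_eq_zero_of_isTangent e (fun p => by rw [Set.mem_ofPred_eq, he]) hL' (htan i))
    refine ⟨s, t, hst, fun p => ?_⟩
    rw [hL', h0, h1, h2]
    ring_nf
  choose s t hst hL using h
  obtain ⟨x, hx⟩ := exists_forall_ne_mul s t hst
  let E : Fin 3 → (Fin 3 → ℂ) →ₗ[ℂ] ℂ := fun i => LinearMap.proj i ∘ₗ e.toLinearMap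
  let T : (Fin 3 → ℂ) →ₗ[ℂ] (Fin 3 → ℂ) :=
    LinearMap.pi ![E 0, E 1 - x • E 0, E 2 - (2 * x) • E 1 + x ^ 2 • E 0]
  have hT : ∀ v, T v 0 = e v 0 ∧ T v 1 = e v 1 - x * e v 0 ∧
      T v 2 = e v 2 - 2 * x * e v 1 + x ^ 2 * e v 0 := fun v => by simp [T, E]
  have hinj : Function.Injective T := by
    rw [injective_iff_map_eq_zero]
    intro v hv
    obtain ⟨t0, t1, t2⟩ := hT v
    simp only [hv, Pi.zero_apply] at t0 t1 t2
    have e1 : e v 1 = 0 := by linear_combination -t1 - x * t0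
    have e2 : e v 2 = 0 := by linear_combination -t2 + 2 * x * e1 + x ^ 2 * t0
    apply e.injective
    ext i
    fin_cases i <;> simp [← t0, e1, e2]
  refine ⟨LinearEquiv.ofInjectiveEndo T hinj, fun i => s i / (t i - x * s i), fun i p => ?_⟩
  obtain ⟨t0, t1, t2⟩ := hT p.rep
  rw [hL]
  simp only [LinearEquiv.coe_ofInjectiveEndo, t0, t1, t2]
  have hy := hx i
  have hscale : ∀ x₀ x₁ x₂ : ℂ, t i ^ 2 * x₀ - 2 * s i * t i * x₁ + s i ^ 2 * x₂ =
      (t i - x * s i) ^ 2 * (x₀ - 2 * (s i / (t i - x * s i)) * (x₁ - x * x₀) +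
        (s i / (t i - x * s i)) ^ 2 * (x₂ - 2 * x * x₁ + x ^ 2 * x₀)) := fun x₀ x₁ x₂ => by
    obtain ⟨y, hty⟩ : ∃ y, t i = y + x * s i := ⟨t i - x * s i, by ring⟩
    rw [hty, add_sub_cancel_right] at hy ⊢
    field_simp
    ring
  rw [hscale, mul_eq_zero, or_iff_right (pow_ne_zero 2 hy)]

/-- The Lagrange expansion of a symmetric function of degree less than `r` in each variable
which vanishes at all off-diagonal pairs of nodes. -/
lemma eq_sum_basis_mul_basis {r : ℕ} {g : ℂ → ℂ → ℂ} (hsymm : ∀ s t, g s t = g t s)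
    (hpoly : ∀ t, ∃ p : Polynomial ℂ, p.degree < r ∧ ∀ s, p.eval s = g s t)
    {a : Fin r → ℂ} (ha : Function.Injective a) (hg : ∀ i j, i ≠ j → g (a i) (a j) = 0)
    (s t : ℂ) : g s t = ∑ i, g (a i) (a i) * ((Lagrange.basis Finset.univ a i).eval s *
      (Lagrange.basis Finset.univ a i).eval t) := by
  have expand : ∀ s t, g s t =
      ∑ i, g (a i) t * (Lagrange.basis Finset.univ a i).eval s := by
    intro s t
    obtain ⟨p, hp, hps⟩ := hpoly t
    have := Lagrange.eq_interpolate (s := Finset.univ) (v := a) ha.injOn (f := p) (by simpa using hp)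
    rw [← hps, this, Lagrange.interpolate_apply, Polynomial.eval_finsetSum]
    simp [hps]
  rw [expand]
  refine Finset.sum_congr rfl fun i _ => ?_
  rw [hsymm, expand, Finset.sum_eq_single i (fun j _ hj => by rw [hg j i hj, zero_mul]) (by simp)]
  ring

/-- If moreover the function vanishes at all pairs `(b i, b k)` for a fixed `k`, then it vanishes
at all off-diagonal pairs `(b i, b j)`. -/
lemma eq_zero_of_eq_zero_on_star {r : ℕ} {g : ℂ → ℂ → ℂ} (hsymm : ∀ s t, g s t = g t s)
    (hpoly : ∀ t, ∃ p : Polynomial ℂ, p.degree < r ∧ ∀ s, p.eval s = g s t)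
    {a b : Fin r → ℂ} (ha : Function.Injective a) (hb : Function.Injective b)
    (hab : ∀ i j, a i ≠ b j) (hg : ∀ i j, i ≠ j → g (a i) (a j) = 0) (k : Fin r)
    (hk : ∀ i, i ≠ k → g (b i) (b k) = 0) {i j : Fin r} (hij : i ≠ j) : g (b i) (b j) = 0 := by
  set N : ℂ → ℂ := fun s => (Lagrange.nodal Finset.univ a).eval s
  set h : ℂ → ℂ := fun s =>
    ∑ l, g (a l) (a l) * Lagrange.nodalWeight Finset.univ a l ^ 2 * (s - a l)⁻¹
  have hN : ∀ j, N (b j) ≠ 0 := fun j =>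
    Lagrange.eval_nodal_not_at_node fun i _ => (hab i j).symm
  have key : ∀ i j, (b i - b j) * g (b i) (b j) = N (b i) * N (b j) * (h (b j) - h (b i)) := by
    intro i j
    rw [eq_sum_basis_mul_basis hsymm hpoly ha hg, ← Finset.sum_sub_distrib, Finset.mul_sum,
      Finset.mul_sum]
    refine Finset.sum_congr rfl fun l hl => ?_
    rw [Lagrange.eval_basis_not_at_node hl (hab l i).symm,
      Lagrange.eval_basis_not_at_node hl (hab l j).symm]
    have hi : b i - a l ≠ 0 := sub_ne_zero.2 (hab l i).symm
    have hj : b j - a l ≠ 0 := sub_ne_zero.2 (hab l j).symm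
    simp only [N]
    field_simp
    ring
  have hconst : ∀ i, h (b i) = h (b k) := by
    intro i
    by_cases hik : i = k
    · rw [hik]
    · have := key i k
      rw [hk i hik, mul_zero, zero_eq_mul] at this
      exact (sub_eq_zero.1 (this.resolve_left (mul_ne_zero (hN i) (hN k)))).symm
  have := key i j
  rw [hconst i, hconst j, sub_self, mul_zero] at this
  exact (mul_eq_zero.1 this).resolve_left (sub_ne_zero.2 (hb.ne hij))

lemma eval_smul_of_isHomogeneous {F : MvPolynomial (Fin 3) ℂ} {d : ℕ} (hF : F.IsHomogeneous d)
    (c : ℂ) (v : Fin 3 → ℂ) : eval (c • v) F = c ^ d * eval v F := by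
  simp only [eval_eq, Finset.mul_sum, Pi.smul_apply, smul_eq_mul, mul_pow, Finset.prod_mul_distrib]
  refine Finset.sum_congr rfl fun m hm => ?_
  have hd : ∑ i ∈ m.support, m i = d := by
    rw [← Finsupp.degree_apply, Finsupp.degree_eq_weight_one]
    exact hF (mem_support_iff.1 hm)
  rw [Finset.prod_pow_eq_pow_sum, hd]
  ring

lemma exists_polynomial_eval_line {F : MvPolynomial (Fin 3) ℂ} {d : ℕ} (hF : F.IsHomogeneous d)
    (u v : Fin 3 → ℂ) : ∃ p : Polynomial ℂ, p.degree < (d + 1 : ℕ) ∧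
      ∀ s, p.eval s = eval (s • u + v) F := by
  refine ⟨aeval (fun i => Polynomial.C (u i) * Polynomial.X + Polynomial.C (v i)) F, ?_, fun s => ?_⟩
  · refine Polynomial.degree_le_natDegree.trans_lt (Nat.cast_lt.2 (Nat.lt_succ_of_le ?_))
    simpa using aeval_natDegree_le F hF.totalDegree_le _ fun i => Polynomial.natDegree_linear_le
  · rw [← Polynomial.coe_evalRingHom, MvPolynomial.aeval_def, MvPolynomial.hom_eval₂]
    rw [← MvPolynomial.eval₂_id]
    congr 1
    · ext; simp
    · ext; simp; ring

/-- The intersection of the tangents `X - 2 s Y + s² Z = 0` and `X - 2 t Y + t² Z = 0`. -/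
lemma tangent_intersection {s t x y z : ℂ} (hst : s ≠ t) (hs : x - 2 * s * y + s ^ 2 * z = 0)
    (ht : x - 2 * t * y + t ^ 2 * z = 0) :
    ![x, y, z] = (z / 2) • ![2 * (s * t), s + t, 2] := by
  have hy : y = z / 2 * (s + t) := by
    apply mul_left_cancel₀ (sub_ne_zero.2 hst)
    linear_combination (ht - hs) / 2
  have hx : x = z / 2 * (2 * (s * t)) := by
    linear_combination hs + 2 * s * hy
  ext i
  fin_cases i <;> simp [← hx, ← hy]

/-- **Theorem (d): degree-`r−1` forms through `X ∪ Z` pass through all of `X ∪ Y`.**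
Let `γ` be an irreducible conic, `r ≥ 2`, and `ℓ₁,…,ℓ_r, m₁,…,m_r` pairwise distinct lines
tangent to `γ`, with `X = 𝕊(ℓ₁,…,ℓ_r)`, `Y = 𝕊(m₁,…,m_r)` and `Z = Y ∩ m_r` the `r−1`
collinear points of `Y` on the last line `m_r`.  Then
`(I_{X∪Z})_{r−1} = (I_{X∪Y})_{r−1}`. -/
theorem degree_component_through_collinear_part
    (γ : Set P2) (hγ : IsIrredConic γ) (r : ℕ) (hr : 2 ≤ r)
    (ℓ : Fin r → Set P2) (m : Fin r → Set P2)
    (hℓline : ∀ i, IsLine (ℓ i)) (hmline : ∀ j, IsLine (m j))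
    (hℓtan : ∀ i, IsTangent (ℓ i) γ) (hmtan : ∀ j, IsTangent (m j) γ)
    (hℓinj : Function.Injective ℓ) (hminj : Function.Injective m)
    (hcross : ∀ i j, ℓ i ≠ m j) :
    idealComp (starConfig ℓ ∪ (starConfig m ∩ m ⟨r - 1, by omega⟩)) (r - 1) =
      idealComp (starConfig ℓ ∪ starConfig m) (r - 1) := by
  obtain ⟨r, rfl⟩ : ∃ d, r = d + 1 := ⟨r - 1, by omega⟩
  simp only [Nat.add_sub_cancel]
  set k : Fin (r + 1) := ⟨r, by omega⟩
  refine le_antisymm ?_ fun F hF => ⟨hF.1, fun p hp => hF.2 p (hp.imp_right And.left)⟩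
  rintro F ⟨hF, hFv⟩
  refine ⟨hF, fun p hp => ?_⟩
  rcases hp with hp | hp
  · exact hFv p (Or.inl hp)
  rw [SetLike.mem_coe, mem_homogeneousSubmodule] at hF
  obtain ⟨e, s, hs⟩ := exists_tangent_coordinates hγ (Sum.elim ℓ m)
    (Sum.rec hℓline hmline) (Sum.rec hℓtan hmtan)
  have hinj : ∀ i j, s i = s j → Sum.elim ℓ m i = Sum.elim ℓ m j := fun i j h => by
    ext p
    rw [hs, hs, h]
  set g : ℂ → ℂ → ℂ := fun s t => eval (e.symm ![2 * (s * t), s + t, 2]) F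
  have hmem : ∀ i j, ∃ p, p ∈ Sum.elim ℓ m i ∧ p ∈ Sum.elim ℓ m j ∧
      (eval p.rep F = 0 → g (s i) (s j) = 0) := by
    intro i j
    obtain ⟨p, c, hc, hp, hep⟩ := exists_point_rep e
      (u := ![2 * (s i * s j), s i + s j, 2]) fun h => by simpa using congrFun h 2
    refine ⟨p, (hs i p).2 ?_, (hs j p).2 ?_, fun h => ?_⟩
    · simp [hep]; ring
    · simp [hep]; ring
    · rw [hp, eval_smul_of_isHomogeneous hF] at h
      exact (mul_eq_zero.1 h).resolve_left (pow_ne_zero _ hc)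
  have hpoly : ∀ t, ∃ p : Polynomial ℂ, p.degree < (r + 1 : ℕ) ∧ ∀ s, p.eval s = g s t := by
    intro t
    obtain ⟨p, hp, h⟩ := exists_polynomial_eval_line hF (e.symm ![2 * t, 1, 0]) (e.symm ![0, t, 2])
    refine ⟨p, hp, fun s => ?_⟩
    rw [h, ← map_smul, ← map_add]
    congr 3
    simp
    ring
  obtain ⟨i, j, hij, hpi, hpj⟩ := hp
  have hzero : g (s (Sum.inr i)) (s (Sum.inr j)) = 0 := by
    refine eq_zero_of_eq_zero_on_star (a := s ∘ Sum.inl) (b := s ∘ Sum.inr) (k := k)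
      (fun s t => by simp only [g, mul_comm, add_comm]) hpoly
      (fun i j h => hℓinj (hinj _ _ h)) (fun i j h => hminj (hinj _ _ h))
      (fun i j h => hcross i j (hinj _ _ h)) (fun i j h => ?_) (fun i h => ?_) hij
    · obtain ⟨p, hi, hj, hp⟩ := hmem (Sum.inl i) (Sum.inl j)
      exact hp (hFv p (Or.inl ⟨i, j, h, hi, hj⟩))
    · obtain ⟨p, hi, hj, hp⟩ := hmem (Sum.inr i) (Sum.inr k)
      exact hp (hFv p (Or.inr ⟨⟨i, k, h, hi, hj⟩, hj⟩))
  have hrep := tangent_intersection (fun h => hij (hminj (hinj (Sum.inr i) (Sum.inr j) h)))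
    ((hs (Sum.inr i) p).1 hpi) ((hs (Sum.inr j) p).1 hpj)
  have hvec : e p.rep = ![e p.rep 0, e p.rep 1, e p.rep 2] := by
    ext i
    fin_cases i <;> rfl
  rw [← e.symm_apply_apply p.rep, hvec, hrep, map_smul, eval_smul_of_isHomogeneous hF]
  exact mul_eq_zero_of_right _ hzero
end
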